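/- arXiv:1204.1837 — 2 statements merged into one kernel-verified Lean document; each statement's English description precedes it below -/
import Mathlib

section
/- A morphism of schemes that is proper, of finite presentation, and has finite fibers (quasi-finite) is finite. -/
open AlgebraicGeometry

/-- A morphism of schemes that is proper, of finite presentation, and has finite
fibers is finite (EGA IV 8.11.1; no noetherian hypothesis). -/
theorem stmt7 {X Y : AlgebraicGeometry.Scheme} (f : X ⟶ Y) [IsProper f]
    [LocallyOfFinitePresentation f]
    (hfib : ∀ y : Y, Set.Finite (f.base ⁻¹' {y})) :
    IsFinite f := by
  have : LocallyQuasiFinite f := .of_finite_preimage_singleton f hfib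
  exact .of_isProper_of_locallyQuasiFinite f
end

section
/- Let R be a valuation ring with fraction field K, and let X be a flat R-scheme of finite type. Then X is of finite presentation over R. -/
/-- Over a valuation ring, the intersection of a finitely generated submodule with a submodule
having torsion-free quotient is finitely generated. -/
theorem ValuationRing.fg_inf_of_isTorsionFree_quotient {R M : Type*} [CommRing R] [IsDomain R]
    [ValuationRing R] [AddCommGroup M] [Module R M] {P N : Submodule R M} (hP : P.FG)
    (hN : Module.IsTorsionFree R (M ⧸ N)) : (P ⊓ N).FG := by
  let φ : P →ₗ[R] M ⧸ N := N.mkQ ∘ₗ P.subtype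
  have : Module.Finite R P := Module.Finite.iff_fg.mpr hP
  have : Module.Flat R (LinearMap.range φ) := by
    rw [Module.Flat.flat_iff_torsion_eq_bot_of_isBezout,
      ← Submodule.isTorsionFree_iff_torsion_eq_bot]
    infer_instance
  have : Module.Free R (LinearMap.range φ) := Module.free_of_flat_of_isLocalRing
  have : Module.FinitePresentation R (LinearMap.range φ) :=
    Module.finitePresentation_of_projective R _
  have hker := Module.FinitePresentation.fg_ker φ.rangeRestrict φ.surjective_rangeRestrict
  have heq : P ⊓ N = (LinearMap.ker φ.rangeRestrict).map P.subtype := by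
    rw [LinearMap.ker_rangeRestrict, LinearMap.ker_comp, Submodule.ker_mkQ,
      Submodule.map_comap_subtype]
  rw [heq]
  exact hker.map _

namespace MvPolynomial

/-- A polynomial over a valuation ring whose coefficients lie in an ideal `I` is a multiple of a
constant in `I`. -/
theorem exists_mem_C_dvd_of_forall_coeff_mem {R σ : Type*} [CommRing R] [IsDomain R]
    [ValuationRing R] {I : Ideal R} {f : MvPolynomial σ R} (hf : ∀ m, f.coeff m ∈ I) :
    ∃ c ∈ I, C c ∣ f := by
  classical
  have hfg : (Ideal.span (f.support.image f.coeff : Set R)).FG := ⟨_, rfl⟩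
  obtain ⟨c, hc⟩ := (IsBezout.isPrincipal_of_FG _ hfg).principal
  refine ⟨c, ?_, (C_dvd_iff_dvd_coeff _ _).mpr fun m ↦ ?_⟩
  · have hle : Ideal.span (f.support.image f.coeff : Set R) ≤ I := by
      rw [Ideal.span_le]
      intro x hx
      obtain ⟨m, -, rfl⟩ := Finset.mem_image.mp (Finset.mem_coe.mp hx)
      exact hf m
    exact hle (hc ▸ Submodule.mem_span_singleton_self c)
  · by_cases hm : m ∈ f.support
    · rw [← Ideal.mem_span_singleton]
      change _ ∈ Submodule.span R {c}
      rw [← hc]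
      exact Ideal.subset_span (Finset.mem_coe.mpr (Finset.mem_image_of_mem _ hm))
    · rw [notMem_support_iff.mp hm]
      exact dvd_zero c

theorem homogeneousComponent_map {R S σ : Type*} [CommSemiring R] [CommSemiring S] (φ : R →+* S)
    (n : ℕ) (p : MvPolynomial σ R) :
    homogeneousComponent n (map φ p) = map φ (homogeneousComponent n p) := by
  ext m
  simp only [coeff_homogeneousComponent, coeff_map]
  split_ifs <;> simp

attribute [local instance] MvPolynomial.gradedAlgebra

/-- A homogeneous ideal of a polynomial ring in finitely many variables over a valuation ring is
finitely generated as soon as its quotient is torsion-free. -/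
theorem _root_.Ideal.IsHomogeneous.fg_of_isTorsionFree_quotient {R σ : Type*} [CommRing R]
    [IsDomain R] [ValuationRing R] [Finite σ] {I : Ideal (MvPolynomial σ R)}
    (hI : I.IsHomogeneous (homogeneousSubmodule σ R))
    (htf : ∀ (r : R) (f : MvPolynomial σ R), r ≠ 0 → C r * f ∈ I → f ∈ I) : I.FG := by
  classical
  let π : MvPolynomial σ R →+* MvPolynomial σ (IsLocalRing.ResidueField R) :=
    map (IsLocalRing.residue R)
  have hπ : Function.Surjective π := map_surjective _ IsLocalRing.residue_surjective
  let H : Set (MvPolynomial σ R) :=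
    {f | f ∈ I ∧ SetLike.IsHomogeneousElem (homogeneousSubmodule σ R) f}
  have hH : Ideal.span H = I := by
    refine le_antisymm (Ideal.span_le.mpr fun f hf ↦ hf.1) fun f hf ↦ ?_
    rw [← sum_homogeneousComponent f]
    exact sum_mem fun n _ ↦ Ideal.subset_span
      ⟨homogeneousComponent_mem_of_mem hI hf n, n, homogeneousComponent_mem n f⟩
  have hfg : (Ideal.span (π '' H)).FG := IsNoetherian.noetherian _
  obtain ⟨s, hs, hspan⟩ := (Submodule.fg_span_iff_fg_span_finset_subset _).mp hfg
  obtain ⟨t, htH, rfl⟩ := Finset.subset_set_image_iff.mp hs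
  have hmap : I.map π = (Ideal.span (t : Set (MvPolynomial σ R))).map π := by
    rw [← hH, Ideal.map_span, Ideal.map_span, ← Finset.coe_image]
    exact hspan
  have hB : (Ideal.span (t : Set (MvPolynomial σ R))).IsHomogeneous (homogeneousSubmodule σ R) :=
    Ideal.homogeneous_span _ _ fun f hf ↦ (htH hf).2
  have hBI : Ideal.span (t : Set (MvPolynomial σ R)) ≤ I :=
    Ideal.span_le.mpr fun f hf ↦ (htH hf).1
  have hquot : Module.IsTorsionFree R (MvPolynomial σ R ⧸ I.restrictScalars R) := by
    refine Module.IsTorsionFree.of_smul_eq_zero fun r x hx ↦ or_iff_not_imp_left.mpr fun hr ↦ ?_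
    obtain ⟨f, rfl⟩ := Submodule.mkQ_surjective _ x
    rw [← map_smul, Submodule.mkQ_apply, Submodule.Quotient.mk_eq_zero,
      Submodule.restrictScalars_mem, ← C_mul'] at hx
    rw [Submodule.mkQ_apply, Submodule.Quotient.mk_eq_zero]
    exact htf r f hr hx
  suffices hdeg : ∀ n, homogeneousSubmodule σ R n ⊓ I.restrictScalars R ≤
      (Ideal.span (t : Set (MvPolynomial σ R))).restrictScalars R by
    refine ⟨t, le_antisymm hBI ?_⟩
    rw [← hH]
    exact Ideal.span_le.mpr fun f ⟨hf, n, hn⟩ ↦ hdeg n ⟨hn, hf⟩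
  intro n
  refine Submodule.le_of_le_smul_of_le_jacobson_bot
    (ValuationRing.fg_inf_of_isTorsionFree_quotient (homogeneousSubmodule_fg σ R n) hquot)
    (IsLocalRing.maximalIdeal_le_jacobson _) ?_
  rintro f ⟨hfn, hfI⟩
  obtain ⟨b, hb, hbf⟩ : ∃ b ∈ Ideal.span (t : Set (MvPolynomial σ R)), π b = π f := by
    rw [← Ideal.mem_map_iff_of_surjective π hπ, ← hmap]
    exact Ideal.mem_map_of_mem π hfI
  have hb' := homogeneousComponent_mem_of_mem hB hb n
  have hbf' : π (homogeneousComponent n b) = π f := by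
    rw [← homogeneousComponent_map, hbf, homogeneousComponent_map,
      homogeneousComponent_eq_self hfn]
  rw [← add_sub_cancel (homogeneousComponent n b) f]
  refine Submodule.add_mem_sup hb' ?_
  obtain ⟨c, hc, g, hg⟩ : ∃ c ∈ IsLocalRing.maximalIdeal R,
      C c ∣ f - homogeneousComponent n b := by
    refine exists_mem_C_dvd_of_forall_coeff_mem fun m ↦ ?_
    rw [← IsLocalRing.residue_eq_zero_iff, ← coeff_map]
    change coeff m (π _) = 0
    rw [map_sub, hbf', sub_self, coeff_zero]
  rcases eq_or_ne c 0 with rfl | hc0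
  · simp [hg]
  have hhom : f - homogeneousComponent n b ∈ homogeneousSubmodule σ R n :=
    sub_mem hfn (homogeneousComponent_mem n b)
  have hmem : f - homogeneousComponent n b ∈ I := sub_mem hfI (hBI hb')
  rw [hg] at hhom hmem ⊢
  rw [C_mul'] at hhom ⊢
  refine Submodule.smul_mem_smul hc ⟨fun m hm ↦ hhom ?_, htf c g hc0 hmem⟩
  rw [coeff_smul]
  exact smul_ne_zero hc0 hm

/-- An ideal of a polynomial ring in finitely many variables over a valuation ring is finitely
generated as soon as its quotient is torsion-free. -/
theorem _root_.Ideal.fg_of_isTorsionFree_quotient_mvPolynomial {R σ : Type*} [CommRing R]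
    [IsDomain R] [ValuationRing R] [Finite σ] {I : Ideal (MvPolynomial σ R)}
    (htf : ∀ (r : R) (f : MvPolynomial σ R), r ≠ 0 → C r * f ∈ I → f ∈ I) : I.FG := by
  let δ : MvPolynomial (Option σ) R →ₐ[R] MvPolynomial σ R := aeval fun i ↦ i.elim 1 X
  have hδ : ∀ p, δ (rename some p) = p := fun p ↦ by
    simp only [δ, aeval_rename, Function.comp_def, Option.elim_some, aeval_X_left_apply]
  let J := (I.comap δ).homogeneousCore (homogeneousSubmodule (Option σ) R)
  have hJ : ∀ f, f ∈ J.toIdeal ↔ ∀ n, δ (homogeneousComponent n f) ∈ I := fun f ↦ by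
    rw [mem_iff_homogeneousComponent_mem J.isHomogeneous]
    refine forall_congr' fun n ↦ ⟨fun h ↦ Ideal.mem_comap.mp (Ideal.toIdeal_homogeneousCore_le _ _ h), fun h ↦ ?_⟩
    exact Ideal.mem_homogeneousCore_of_homogeneous_of_mem ⟨n, homogeneousComponent_mem n f⟩ h
  have hJfg : J.toIdeal.FG := by
    refine J.isHomogeneous.fg_of_isTorsionFree_quotient fun r f hr hf ↦ ?_
    rw [hJ] at hf ⊢
    intro n
    refine htf r _ hr ?_
    have := hf n
    rwa [homogeneousComponent_C_mul, map_mul, ← algebraMap_eq, AlgHom.commutes] at this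
  have hIJ : J.toIdeal.map δ.toRingHom = I := by
    refine le_antisymm (Ideal.map_le_iff_le_comap.mpr (Ideal.toIdeal_homogeneousCore_le _ _)) ?_
    intro p hp
    let q : MvPolynomial (Option σ) R := ∑ i ∈ Finset.range (p.totalDegree + 1),
      X none ^ (p.totalDegree - i) * rename some (homogeneousComponent i p)
    have hq : δ q = p := by
      simp only [q, map_sum, map_mul, hδ, map_pow]
      conv_rhs => rw [← sum_homogeneousComponent p]
      refine Finset.sum_congr rfl fun i _ ↦ ?_
      simp [δ]
    have hqhom : q.IsHomogeneous p.totalDegree := by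
      refine IsHomogeneous.sum _ _ _ fun i hi ↦ ?_
      have h := (isHomogeneous_X_pow (R := R) (none : Option σ) (p.totalDegree - i)).mul
        ((homogeneousComponent_isHomogeneous i p).rename_isHomogeneous (f := some))
      rwa [Nat.sub_add_cancel (Nat.lt_succ_iff.mp (Finset.mem_range.mp hi))] at h
    rw [← hq]
    refine Ideal.mem_map_of_mem δ.toRingHom
      (Ideal.mem_homogeneousCore_of_homogeneous_of_mem ⟨_, hqhom⟩ ?_)
    rw [Ideal.mem_comap, hq]
    exact hp
  rw [← hIJ]
  exact hJfg.map _

end MvPolynomial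

/-- Over a valuation ring `R`, a flat algebra of finite type is of finite presentation
(Raynaud–Gruson 3.4.7 in the valuation ring case; affine formulation). -/
theorem stmt8 (R A : Type*) [CommRing R] [IsDomain R] [ValuationRing R]
    [CommRing A] [Algebra R A] [Module.Flat R A] [Algebra.FiniteType R A] :
    Algebra.FinitePresentation R A := by
  obtain ⟨n, f, hf⟩ := Algebra.FiniteType.iff_quotient_mvPolynomial''.mp ‹Algebra.FiniteType R A›
  refine ⟨n, f, hf, Ideal.fg_of_isTorsionFree_quotient_mvPolynomial fun r p hr hp ↦ ?_⟩
  have h : f (MvPolynomial.C r * p) = 0 := hp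
  rw [MvPolynomial.C_mul', map_smul] at h
  exact (smul_eq_zero.mp h).resolve_left hr
end
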